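/- (One-coin Dawid–Skene error expression.) Let w, β be OCDS parameters with 0 < w_ℓ < 1, Σ_ℓ w_ℓ = 1, 0 < β_j < 1, and let w*, β* be the empirical parameters: w*_ℓ := (1/n)·Σ_i η_{iℓ} and β*_j := (1/n_j)·Σ_i Σ_ℓ η_{iℓ}·[h j i = some ℓ]; assume 0 < w*_ℓ < 1 and 0 < β*_j < 1 for all ℓ, j. For a prediction pattern t : Fin p → Option (Fin k), set Z*_t := (1/n)·|{i : ∀ j, h j i = t j}| and Z(w,β)_t := Σ_ℓ w_ℓ · Π_{j : t j = some ℓ} β_j · Π_{j : ∃ ℓ' ≠ ℓ, t j = some ℓ'} (1−β_j)/(k−1). Then d(η, g^{ds}(w,β)) − d(η, g^{ds}(w*,β*)) = n·( Σ_ℓ w*_ℓ·log(w*_ℓ/w_ℓ) + Σ_j (n_j/n)·( β*_j·log(β*_j/β_j) + (1−β*_j)·log((1−β*_j)/(1−β_j)) ) + Σ_t Z*_t·log( Z*_t / Z(w*,β*)_t ) − Σ_t Z*_t·log( Z*_t / Z(w,β)_t ) ), where the sums over t range over all patterns and use the convention 0·log 0 = 0. -/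

import Mathlib

open Finset

attribute [local instance] Classical.propDecidable

noncomputable section

/-- The simplex `Δ_k^n`: rows are probability distributions over `Fin k`. -/
def Simplex (n k : ℕ) : Set (Fin n → Fin k → ℝ) :=
  {z | (∀ i ℓ, 0 ≤ z i ℓ) ∧ ∀ i, ∑ ℓ, z i ℓ = 1}

/-- Number of points where rule `j` does not abstain. -/
def nRule {n k p : ℕ} (h : Fin p → Fin n → Option (Fin k)) (j : Fin p) : ℕ :=
  (Finset.univ.filter (fun i => h j i ≠ none)).card

/-- The constraint matrix `A`, with `m = p + k` rows indexed by `Fin p ⊕ Fin k`. -/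
def Amat {n k p : ℕ} (h : Fin p → Fin n → Option (Fin k)) :
    Fin p ⊕ Fin k → Fin n → Fin k → ℝ
  | Sum.inl j => fun i ℓ => if h j i = some ℓ then 1 / (nRule h j : ℝ) else 0
  | Sum.inr ℓ' => fun i ℓ => if ℓ = ℓ' then 1 / (n : ℝ) else 0

/-- `(A z)_j`. -/
def applyA {n k p : ℕ} (h : Fin p → Fin n → Option (Fin k))
    (z : Fin n → Fin k → ℝ) (j : Fin p ⊕ Fin k) : ℝ :=
  ∑ i, ∑ ℓ, Amat h j i ℓ * z i ℓ

/-- The polytope `P(b, ε)`. -/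
def Polytope {n k p : ℕ} (h : Fin p → Fin n → Option (Fin k))
    (b ε : Fin p ⊕ Fin k → ℝ) : Set (Fin n → Fin k → ℝ) :=
  {z | z ∈ Simplex n k ∧ ∀ j, b j - ε j ≤ applyA h z j ∧ applyA h z j ≤ b j + ε j}

/-- Extended-real logarithm, with `elog 0 = ⊥ = -∞`. -/
def elog (x : ℝ) : EReal := if x = 0 then ⊥ else ((Real.log x : ℝ) : EReal)

/-- `z · log g`, valued in `[-∞, 0]` with the convention `0 · log 0 = 0`. -/
def dotlog {n k : ℕ} (z g : Fin n → Fin k → ℝ) : EReal :=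
  ∑ i, ∑ ℓ, (z i ℓ : EReal) * elog (g i ℓ)

/-- `a^{(θ)}_{iℓ} = Σ_j θ_j · A j i ℓ`. -/
def avec {n k p : ℕ} (h : Fin p → Fin n → Option (Fin k))
    (θ : Fin p ⊕ Fin k → ℝ) (i : Fin n) (ℓ : Fin k) : ℝ :=
  ∑ j, θ j * Amat h j i ℓ

/-- The exponential-family (softmax) prediction `g^{(θ)}`. -/
def gexp {n k p : ℕ} (h : Fin p → Fin n → Option (Fin k))
    (θ : Fin p ⊕ Fin k → ℝ) (i : Fin n) (ℓ : Fin k) : ℝ :=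
  Real.exp (avec h θ i ℓ) / ∑ ℓ', Real.exp (avec h θ i ℓ')

/-- The BF dual objective `(σ'−σ)·b − (σ'+σ)·ε − Σ_i log(Σ_ℓ exp(a^{(σ'−σ)}_{iℓ}))`. -/
def dualObj {n k p : ℕ} (h : Fin p → Fin n → Option (Fin k))
    (b ε σ σ' : Fin p ⊕ Fin k → ℝ) : ℝ :=
  (∑ j, (σ' j - σ j) * b j) - (∑ j, (σ' j + σ j) * ε j)
    - ∑ i, Real.log (∑ ℓ, Real.exp (avec h (fun j => σ' j - σ j) i ℓ))

/-- KL summand `a·log(a/c)`, with `0·log(0/c) = 0` and `a·log(a/0) = ⊤` for `a ≠ 0`. -/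
def klTerm (a c : ℝ) : EReal :=
  if a = 0 then 0 else if c = 0 then ⊤ else ((a * Real.log (a / c) : ℝ) : EReal)

/-- `d(μ, ν)`, the summed KL divergences, valued in `[0, +∞]`. -/
def dKL {n k : ℕ} (μ ν : Fin n → Fin k → ℝ) : EReal :=
  ∑ i, ∑ ℓ, klTerm (μ i ℓ) (ν i ℓ)

/-- Unnormalized one-coin Dawid–Skene score `N_{iℓ}`. -/
def Nds {n k p : ℕ} (h : Fin p → Fin n → Option (Fin k))
    (w : Fin k → ℝ) (β : Fin p → ℝ) (i : Fin n) (ℓ : Fin k) : ℝ :=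
  w ℓ * (∏ j ∈ Finset.univ.filter (fun j => h j i = some ℓ), β j)
    * ∏ j ∈ Finset.univ.filter (fun j => ∃ ℓ' ≠ ℓ, h j i = some ℓ'),
        (1 - β j) / ((k : ℝ) - 1)

/-- The one-coin Dawid–Skene prediction `g^{ds}(w, β)`. -/
def gds {n k p : ℕ} (h : Fin p → Fin n → Option (Fin k))
    (w : Fin k → ℝ) (β : Fin p → ℝ) (i : Fin n) (ℓ : Fin k) : ℝ :=
  Nds h w β i ℓ / ∑ ℓ', Nds h w β i ℓ'

/-- Empirical frequency `Z*_t` of the prediction pattern `t`. -/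
def Zemp {n k p : ℕ} (h : Fin p → Fin n → Option (Fin k))
    (t : Fin p → Option (Fin k)) : ℝ :=
  ((Finset.univ.filter (fun i : Fin n => ∀ j, h j i = t j)).card : ℝ) / n

/-- OCDS-modeled probability `Z(w,β)_t` of the prediction pattern `t`. -/
def Zds {k p : ℕ} (w : Fin k → ℝ) (β : Fin p → ℝ) (t : Fin p → Option (Fin k)) : ℝ :=
  ∑ ℓ, w ℓ * (∏ j ∈ Finset.univ.filter (fun j => t j = some ℓ), β j)
    * ∏ j ∈ Finset.univ.filter (fun j => ∃ ℓ' ≠ ℓ, t j = some ℓ'),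
        (1 - β j) / ((k : ℝ) - 1)

theorem sum_Nds {n k p : ℕ} (h : Fin p → Fin n → Option (Fin k))
    (w : Fin k → ℝ) (β : Fin p → ℝ) (i : Fin n) :
    ∑ ℓ, Nds h w β i ℓ = Zds w β (fun j => h j i) := rfl

/-- The per-class pieces of an OCDS score are positive. -/
theorem ds_score_pos {k p : ℕ} (hk : 2 ≤ k) {w : Fin k → ℝ} {β : Fin p → ℝ}
    (hw : ∀ ℓ, 0 < w ℓ) (hβ : ∀ j, 0 < β j ∧ β j < 1) (s s' : Finset (Fin p)) (ℓ : Fin k) :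
    0 < w ℓ * (∏ j ∈ s, β j) * ∏ j ∈ s', (1 - β j) / ((k : ℝ) - 1) := by
  have hk' : (0 : ℝ) < (k : ℝ) - 1 := by
    have : (2 : ℝ) ≤ k := by exact_mod_cast hk
    linarith
  exact mul_pos (mul_pos (hw ℓ) (Finset.prod_pos fun j _ => (hβ j).1))
    (Finset.prod_pos fun j _ => div_pos (sub_pos.2 (hβ j).2) hk')

theorem Nds_pos {n k p : ℕ} (hk : 2 ≤ k) (h : Fin p → Fin n → Option (Fin k))
    {w : Fin k → ℝ} {β : Fin p → ℝ} (hw : ∀ ℓ, 0 < w ℓ) (hβ : ∀ j, 0 < β j ∧ β j < 1)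
    (i : Fin n) (ℓ : Fin k) : 0 < Nds h w β i ℓ :=
  ds_score_pos hk hw hβ _ _ ℓ

theorem Zds_pos {k p : ℕ} (hk : 2 ≤ k) {w : Fin k → ℝ} {β : Fin p → ℝ}
    (hw : ∀ ℓ, 0 < w ℓ) (hβ : ∀ j, 0 < β j ∧ β j < 1) (t : Fin p → Option (Fin k)) :
    0 < Zds w β t :=
  Finset.sum_pos (fun ℓ _ => ds_score_pos hk hw hβ _ _ ℓ) ⟨⟨0, by omega⟩, Finset.mem_univ _⟩

theorem coe_finset_sum_ereal {ι : Type*} (s : Finset ι) (f : ι → ℝ) :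
    ((∑ i ∈ s, f i : ℝ) : EReal) = ∑ i ∈ s, (f i : EReal) :=
  map_sum (⟨⟨Real.toEReal, EReal.coe_zero⟩, EReal.coe_add⟩ : ℝ →+ EReal) f s

/-- For nowhere-vanishing second argument, `dKL` is the real-valued divergence. -/
theorem dKL_eq_coe {n k : ℕ} (μ ν : Fin n → Fin k → ℝ) (hν : ∀ i ℓ, ν i ℓ ≠ 0) :
    dKL μ ν = ((∑ i, ∑ ℓ, μ i ℓ * Real.log (μ i ℓ / ν i ℓ) : ℝ) : EReal) := by
  simp only [dKL, coe_finset_sum_ereal]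
  refine Finset.sum_congr rfl fun i _ => Finset.sum_congr rfl fun ℓ _ => ?_
  by_cases h0 : μ i ℓ = 0
  · simp [klTerm, h0]
  · simp [klTerm, h0, hν i ℓ]

/-- Averaging a function of the pattern against the empirical pattern distribution. -/
theorem card_mul_sum_Zemp_mul {n k p : ℕ} (hn : 0 < n) (h : Fin p → Fin n → Option (Fin k))
    (F : (Fin p → Option (Fin k)) → ℝ) :
    (n : ℝ) * ∑ t, Zemp h t * F t = ∑ i, F (fun j => h j i) := by
  have hn' : (n : ℝ) ≠ 0 := by exact_mod_cast hn.ne'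
  rw [← Finset.sum_fiberwise Finset.univ (fun i j => h j i) (fun i => F (fun j => h j i)),
    Finset.mul_sum]
  refine Finset.sum_congr rfl fun t _ => ?_
  have hc : ∀ i ∈ Finset.univ.filter (fun i : Fin n => (fun j => h j i) = t),
      F (fun j => h j i) = F t := fun i hi => by rw [(Finset.mem_filter.1 hi).2]
  rw [Finset.sum_congr rfl hc, Finset.sum_const, nsmul_eq_mul, Zemp]
  have hf : Finset.univ.filter (fun i : Fin n => ∀ j, h j i = t j)
      = Finset.univ.filter (fun i : Fin n => (fun j => h j i) = t) :=
    Finset.filter_congr fun i _ => funext_iff.symm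
  rw [hf]
  field_simp

theorem card_mul_sum_Zemp_mul_log_div {n k p : ℕ} (hn : 0 < n)
    (h : Fin p → Fin n → Option (Fin k)) (Z : (Fin p → Option (Fin k)) → ℝ)
    (hZ : ∀ t, 0 < Z t) :
    (n : ℝ) * ∑ t, Zemp h t * Real.log (Zemp h t / Z t)
      = (n : ℝ) * ∑ t, Zemp h t * Real.log (Zemp h t) - ∑ i, Real.log (Z fun j => h j i) := by
  rw [← card_mul_sum_Zemp_mul hn h (fun t => Real.log (Z t)), ← mul_sub,
    ← Finset.sum_sub_distrib]
  congr 1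
  refine Finset.sum_congr rfl fun t _ => ?_
  by_cases h0 : Zemp h t = 0
  · simp [h0]
  · rw [Real.log_div h0 (hZ t).ne']; ring

theorem log_Nds {n k p : ℕ} (hk : 2 ≤ k) (h : Fin p → Fin n → Option (Fin k))
    {w : Fin k → ℝ} {β : Fin p → ℝ} (hw : ∀ ℓ, 0 < w ℓ) (hβ : ∀ j, 0 < β j ∧ β j < 1)
    (i : Fin n) (ℓ : Fin k) :
    Real.log (Nds h w β i ℓ) = Real.log (w ℓ) + ∑ j,
      ((if h j i = some ℓ then (1 : ℝ) else 0) * Real.log (β j)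
        + ((if h j i ≠ none then (1 : ℝ) else 0) - if h j i = some ℓ then (1 : ℝ) else 0)
          * Real.log ((1 - β j) / ((k : ℝ) - 1))) := by
  have hk' : (0 : ℝ) < (k : ℝ) - 1 := by
    have : (2 : ℝ) ≤ k := by exact_mod_cast hk
    linarith
  have hβ' : ∀ j, 0 < (1 - β j) / ((k : ℝ) - 1) := fun j => div_pos (sub_pos.2 (hβ j).2) hk'
  have h1 := Finset.prod_pos (s := Finset.univ.filter (fun j => h j i = some ℓ))
    fun j _ => (hβ j).1
  have h2 := Finset.prod_pos
    (s := Finset.univ.filter (fun j => ∃ ℓ' ≠ ℓ, h j i = some ℓ')) fun j _ => hβ' j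
  rw [Nds, Real.log_mul (mul_pos (hw ℓ) h1).ne' h2.ne', Real.log_mul (hw ℓ).ne' h1.ne',
    Real.log_prod fun j _ => (hβ j).1.ne', Real.log_prod fun j _ => (hβ' j).ne',
    Finset.sum_filter, Finset.sum_filter, add_assoc, ← Finset.sum_add_distrib]
  congr 1
  refine Finset.sum_congr rfl fun j _ => ?_
  rcases hji : h j i with _ | a
  · simp
  · by_cases ha : a = ℓ <;> simp [ha]

/-- The cross term `Σ η log N` depends on `η` only through the empirical parameters. -/
theorem sum_mul_log_Nds {n k p : ℕ} (hn : 0 < n) (hk : 2 ≤ k)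
    (h : Fin p → Fin n → Option (Fin k)) (hnj : ∀ j, 0 < nRule h j)
    (η : Fin n → Fin k → ℝ) (hη : η ∈ Simplex n k)
    (wstar : Fin k → ℝ) (hwstardef : ∀ ℓ, wstar ℓ = (∑ i, η i ℓ) / n)
    (βstar : Fin p → ℝ)
    (hβstardef : ∀ j, βstar j
        = (∑ i, ∑ ℓ, η i ℓ * (if h j i = some ℓ then (1 : ℝ) else 0)) / (nRule h j : ℝ))
    {w : Fin k → ℝ} {β : Fin p → ℝ} (hw : ∀ ℓ, 0 < w ℓ) (hβ : ∀ j, 0 < β j ∧ β j < 1) :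
    ∑ i, ∑ ℓ, η i ℓ * Real.log (Nds h w β i ℓ)
      = n * ∑ ℓ, wstar ℓ * Real.log (w ℓ)
        + ∑ j, (nRule h j : ℝ) * (βstar j * Real.log (β j)
          + (1 - βstar j) * Real.log ((1 - β j) / ((k : ℝ) - 1))) := by
  have hn' : (n : ℝ) ≠ 0 := by exact_mod_cast hn.ne'
  have hwn : ∀ ℓ, ∑ i, η i ℓ = n * wstar ℓ := fun ℓ => by
    rw [hwstardef]; field_simp
  have hβn : ∀ j, ∑ i, ∑ ℓ, η i ℓ * (if h j i = some ℓ then (1 : ℝ) else 0)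
      = nRule h j * βstar j := fun j => by
    have : (nRule h j : ℝ) ≠ 0 := by exact_mod_cast (hnj j).ne'
    rw [hβstardef]; field_simp
  have hcount : ∀ j, ∑ i, (if h j i ≠ none then (1 : ℝ) else 0) = nRule h j := fun j => by
    rw [nRule, Finset.sum_boole]
  simp only [log_Nds hk h hw hβ, mul_add, Finset.sum_add_distrib, Finset.mul_sum]
  congr 1
  · rw [Finset.sum_comm]
    refine Finset.sum_congr rfl fun ℓ _ => ?_
    rw [← Finset.sum_mul, hwn, mul_assoc]
  · rw [← Finset.sum_add_distrib]
    have hswap : ∀ f : Fin n → Fin k → Fin p → ℝ,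
        ∑ i, ∑ ℓ, ∑ j, f i ℓ j = ∑ j, ∑ i, ∑ ℓ, f i ℓ j := fun f => by
      rw [Finset.sum_comm (s := (Finset.univ : Finset (Fin p)))]
      exact Finset.sum_congr rfl fun i _ => Finset.sum_comm
    simp only [hswap, ← Finset.sum_add_distrib]
    refine Finset.sum_congr rfl fun j _ => ?_
    have e : ∀ i ℓ, η i ℓ * ((if h j i = some ℓ then (1 : ℝ) else 0) * Real.log (β j))
        + η i ℓ * (((if h j i ≠ none then (1 : ℝ) else 0)
          - if h j i = some ℓ then (1 : ℝ) else 0) * Real.log ((1 - β j) / ((k : ℝ) - 1)))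
        = η i ℓ * (if h j i = some ℓ then (1 : ℝ) else 0)
            * (Real.log (β j) - Real.log ((1 - β j) / ((k : ℝ) - 1)))
          + η i ℓ * (if h j i ≠ none then (1 : ℝ) else 0)
            * Real.log ((1 - β j) / ((k : ℝ) - 1)) := fun i ℓ => by ring
    simp only [e, Finset.sum_add_distrib, ← Finset.sum_mul, hβn, hη.2, one_mul, hcount]
    ring

theorem sum_mul_log_div_gds {n k p : ℕ} (hk : 2 ≤ k)
    (h : Fin p → Fin n → Option (Fin k)) (η : Fin n → Fin k → ℝ) (hη : η ∈ Simplex n k)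
    {w : Fin k → ℝ} {β : Fin p → ℝ} (hw : ∀ ℓ, 0 < w ℓ) (hβ : ∀ j, 0 < β j ∧ β j < 1) :
    ∑ i, ∑ ℓ, η i ℓ * Real.log (η i ℓ / gds h w β i ℓ)
      = ∑ i, ∑ ℓ, η i ℓ * Real.log (η i ℓ) - ∑ i, ∑ ℓ, η i ℓ * Real.log (Nds h w β i ℓ)
        + ∑ i, Real.log (Zds w β fun j => h j i) := by
  rw [← Finset.sum_sub_distrib, ← Finset.sum_add_distrib]
  refine Finset.sum_congr rfl fun i _ => ?_
  have hZ := Zds_pos hk hw hβ (fun j => h j i)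
  have hlog : Real.log (Zds w β fun j => h j i)
      = ∑ ℓ, η i ℓ * Real.log (Zds w β fun j => h j i) := by
    rw [← Finset.sum_mul, hη.2, one_mul]
  rw [hlog, ← Finset.sum_sub_distrib, ← Finset.sum_add_distrib]
  refine Finset.sum_congr rfl fun ℓ _ => ?_
  by_cases h0 : η i ℓ = 0
  · simp [h0]
  · have hN := Nds_pos hk h hw hβ i ℓ
    rw [gds, sum_Nds, Real.log_div h0 (div_pos hN hZ).ne', Real.log_div hN.ne' hZ.ne']
    ring

theorem gds_ne_zero {n k p : ℕ} (hk : 2 ≤ k) (h : Fin p → Fin n → Option (Fin k))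
    {w : Fin k → ℝ} {β : Fin p → ℝ} (hw : ∀ ℓ, 0 < w ℓ) (hβ : ∀ j, 0 < β j ∧ β j < 1)
    (i : Fin n) (ℓ : Fin k) : gds h w β i ℓ ≠ 0 := by
  rw [gds, sum_Nds]
  exact (div_pos (Nds_pos hk h hw hβ i ℓ) (Zds_pos hk hw hβ _)).ne'

/-- one-coin Dawid–Skene error expression. -/
theorem stmt17 {n k p : ℕ} (hn : 0 < n) (hk : 2 ≤ k) (hp : 0 < p)
    (h : Fin p → Fin n → Option (Fin k)) (hnj : ∀ j, 0 < nRule h j)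
    (η : Fin n → Fin k → ℝ) (hη : η ∈ Simplex n k)
    (w : Fin k → ℝ) (β : Fin p → ℝ)
    (hw : ∀ ℓ, 0 < w ℓ ∧ w ℓ < 1) (hwsum : ∑ ℓ, w ℓ = 1)
    (hβ : ∀ j, 0 < β j ∧ β j < 1)
    (wstar : Fin k → ℝ) (hwstardef : ∀ ℓ, wstar ℓ = (∑ i, η i ℓ) / n)
    (βstar : Fin p → ℝ)
    (hβstardef : ∀ j, βstar j
        = (∑ i, ∑ ℓ, η i ℓ * (if h j i = some ℓ then (1 : ℝ) else 0)) / (nRule h j : ℝ))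
    (hwstar : ∀ ℓ, 0 < wstar ℓ ∧ wstar ℓ < 1)
    (hβstar : ∀ j, 0 < βstar j ∧ βstar j < 1) :
    dKL η (gds h w β) - dKL η (gds h wstar βstar)
      = (((n : ℝ) * ((∑ ℓ, wstar ℓ * Real.log (wstar ℓ / w ℓ))
          + (∑ j, ((nRule h j : ℝ) / n) * (βstar j * Real.log (βstar j / β j)
              + (1 - βstar j) * Real.log ((1 - βstar j) / (1 - β j))))
          + (∑ t : Fin p → Option (Fin k),
              Zemp h t * Real.log (Zemp h t / Zds wstar βstar t))
          - ∑ t : Fin p → Option (Fin k),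
              Zemp h t * Real.log (Zemp h t / Zds w β t)) : ℝ) : EReal) := by
  have hw0 : ∀ ℓ, 0 < w ℓ := fun ℓ => (hw ℓ).1
  have hws0 : ∀ ℓ, 0 < wstar ℓ := fun ℓ => (hwstar ℓ).1
  have hn' : (n : ℝ) ≠ 0 := by exact_mod_cast hn.ne'
  have hk' : (0 : ℝ) < (k : ℝ) - 1 := by
    have : (2 : ℝ) ≤ k := by exact_mod_cast hk
    linarith
  rw [dKL_eq_coe _ _ (gds_ne_zero hk h hw0 hβ), dKL_eq_coe _ _ (gds_ne_zero hk h hws0 hβstar),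
    ← EReal.coe_sub, EReal.coe_eq_coe_iff, sum_mul_log_div_gds hk h η hη hw0 hβ,
    sum_mul_log_div_gds hk h η hη hws0 hβstar,
    sum_mul_log_Nds hn hk h hnj η hη wstar hwstardef βstar hβstardef hw0 hβ,
    sum_mul_log_Nds hn hk h hnj η hη wstar hwstardef βstar hβstardef hws0 hβstar,
    mul_sub, mul_add, mul_add, card_mul_sum_Zemp_mul_log_div hn h _ (Zds_pos hk hw0 hβ),
    card_mul_sum_Zemp_mul_log_div hn h _ (Zds_pos hk hws0 hβstar)]
  have hfreq : ∑ ℓ, wstar ℓ * Real.log (wstar ℓ / w ℓ)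
      = ∑ ℓ, wstar ℓ * Real.log (wstar ℓ) - ∑ ℓ, wstar ℓ * Real.log (w ℓ) := by
    rw [← Finset.sum_sub_distrib]
    refine Finset.sum_congr rfl fun ℓ _ => ?_
    rw [Real.log_div (hws0 ℓ).ne' (hw0 ℓ).ne', mul_sub]
  have hacc : (n : ℝ) * ∑ j, ((nRule h j : ℝ) / n) * (βstar j * Real.log (βstar j / β j)
        + (1 - βstar j) * Real.log ((1 - βstar j) / (1 - β j)))
      = ∑ j, (nRule h j : ℝ) * (βstar j * Real.log (βstar j)
          + (1 - βstar j) * Real.log ((1 - βstar j) / ((k : ℝ) - 1)))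
        - ∑ j, (nRule h j : ℝ) * (βstar j * Real.log (β j)
          + (1 - βstar j) * Real.log ((1 - β j) / ((k : ℝ) - 1))) := by
    rw [Finset.mul_sum, ← Finset.sum_sub_distrib]
    refine Finset.sum_congr rfl fun j _ => ?_
    have h1 : 1 - βstar j ≠ 0 := (sub_pos.2 (hβstar j).2).ne'
    have h2 : 1 - β j ≠ 0 := (sub_pos.2 (hβ j).2).ne'
    rw [Real.log_div (hβstar j).1.ne' (hβ j).1.ne', Real.log_div h1 h2,
      Real.log_div h1 hk'.ne', Real.log_div h2 hk'.ne', ← mul_assoc, mul_div_cancel₀ _ hn']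
    ring
  rw [hfreq, hacc]
  ring
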